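/- arXiv:1103.4878 — 2 statements merged into one kernel-verified Lean document; each statement's English description precedes it below -/
import Mathlib

section
/- Let p be a prime, τ ∈ K\{0\} for a number field K with a place v above p, and Λ ∈ GL_ν(ℚ) with all eigenvalues in ℚ ∩ ℤ_p \ ℤ. Then lim_{n→+∞} ‖C_{Λ,τ}(n)‖_v^{1/n} = |τ|_v^{-1} · p^{-1/(p-1)}, where C_{Λ,τ}(n) = τ^{-n}(Λ+nI)⋯(Λ+I) and ‖·‖_v is the entrywise max v-adic norm. -/
open Filter

section

variable {K : Type*} [Field K] {ι : Type*} [Fintype ι] [DecidableEq ι]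

/-- `upProd Λ n = (Λ + nI)(Λ + (n-1)I)⋯(Λ + I)`. -/
def upProd (Λ : Matrix ι ι K) : ℕ → Matrix ι ι K
  | 0 => 1
  | m + 1 => (Λ + ((m : K) + 1) • (1 : Matrix ι ι K)) * upProd Λ m

end

/-- Entrywise max norm of a matrix over a normed field. -/
noncomputable def matMaxNorm {L : Type*} [NormedField L] {m n : Type*} [Fintype m] [Fintype n]
    [Nonempty m] [Nonempty n] (Y : Matrix m n L) : ℝ :=
  Finset.univ.sup' Finset.univ_nonempty
    (fun i : m => Finset.univ.sup' Finset.univ_nonempty (fun j : n => ‖Y i j‖))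

section
variable (p : ℕ) [hpf : Fact p.Prime] {L : Type*} [NontriviallyNormedField L] [IsUltrametricDist L]

lemma aux_coprime (hp : ‖(p : L)‖ = (p : ℝ)⁻¹) (n : ℕ) (h : ¬ p ∣ n) : ‖(n : L)‖ = 1 := by
  have hc : IsCoprime (p : ℤ) (n : ℤ) :=
    Nat.isCoprime_iff_coprime.2 ((Nat.Prime.coprime_iff_not_dvd hpf.out).2 h)
  obtain ⟨u, v, huv⟩ := hc
  have h1 : ((u : L) * p + v * n) = 1 := by exact_mod_cast congrArg (Int.cast : ℤ → L) huv
  have hp1 : (1 : ℝ) < p := by exact_mod_cast hpf.out.one_lt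
  have hle : ‖(n : L)‖ ≤ 1 := IsUltrametricDist.norm_natCast_le_one L n
  by_contra hne
  have hlt : ‖(n : L)‖ < 1 := lt_of_le_of_ne hle hne
  have h2 : ‖(u : L) * p‖ < 1 := by
    rw [norm_mul, hp]
    have := IsUltrametricDist.norm_intCast_le_one L u
    calc _ ≤ 1 * (p : ℝ)⁻¹ := by gcongr
      _ < 1 := by rw [one_mul]; exact inv_lt_one_of_one_lt₀ hp1
  have h3 : ‖(v : L) * n‖ < 1 := by
    rw [norm_mul]
    have := IsUltrametricDist.norm_intCast_le_one L v
    calc _ ≤ 1 * ‖(n : L)‖ := by gcongr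
      _ < 1 := by rwa [one_mul]
  have h4 := IsUltrametricDist.norm_add_le_max ((u : L) * p) (v * n)
  rw [h1, norm_one] at h4
  exact absurd h4 (not_le.2 (max_lt h2 h3))

lemma aux_norm_nat (hp : ‖(p : L)‖ = (p : ℝ)⁻¹) (n : ℕ) (h : n ≠ 0) :
    ‖(n : L)‖ = ((p : ℝ) ^ (padicValNat p n))⁻¹ := by
  obtain ⟨k, m, hm, hn⟩ := Nat.exists_eq_pow_mul_and_not_dvd h p hpf.out.ne_one
  have hm0 : m ≠ 0 := by rintro rfl; simp at hm
  have hv : padicValNat p n = k := by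
    rw [hn, padicValNat.mul (pow_ne_zero _ hpf.out.ne_zero) hm0, padicValNat.prime_pow,
      padicValNat.eq_zero_of_not_dvd hm, add_zero]
  rw [hv, hn]
  push_cast
  rw [norm_mul, norm_pow, hp, aux_coprime p hp m hm, mul_one, inv_pow]

lemma aux_nat_lower (hp : ‖(p : L)‖ = (p : ℝ)⁻¹) (n : ℕ) (h : n ≠ 0) :
    (n : ℝ)⁻¹ ≤ ‖(n : L)‖ := by
  rw [aux_norm_nat p hp n h]
  have hp0 : (0 : ℝ) < p := by exact_mod_cast hpf.out.pos
  have : p ^ padicValNat p n ≤ n := Nat.le_of_dvd (Nat.pos_of_ne_zero h) pow_padicValNat_dvd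
  have : (p : ℝ) ^ padicValNat p n ≤ n := by exact_mod_cast this
  gcongr

lemma aux_int_lower (hp : ‖(p : L)‖ = (p : ℝ)⁻¹) (z : ℤ) (h : z ≠ 0) :
    (z.natAbs : ℝ)⁻¹ ≤ ‖(z : L)‖ := by
  have : ‖(z : L)‖ = ‖(z.natAbs : L)‖ := by
    rcases Int.natAbs_eq z with h | h
    · conv_lhs => rw [h]
      simp
    · conv_lhs => rw [h]
      simp
  rw [this]
  exact aux_nat_lower p hp _ (by simpa using h)

/-- The radius. -/
noncomputable def auxPi (p : ℕ) : ℝ := (p : ℝ) ^ (-(1 : ℝ) / ((p : ℝ) - 1))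

lemma aux_fact (hp : ‖(p : L)‖ = (p : ℝ)⁻¹) (m : ℕ) :
    ‖(m.factorial : L)‖ = auxPi p ^ m * (p : ℝ) ^ (((p.digits m).sum : ℝ) / ((p : ℝ) - 1)) := by
  rw [aux_norm_nat p hp _ m.factorial_ne_zero]
  have h := sub_one_mul_padicValNat_factorial (p := p) m
  have hs : (p.digits m).sum ≤ m := Nat.digit_sum_le p m
  have hp1 : (1 : ℝ) < p := by exact_mod_cast hpf.out.one_lt
  have hp0 : (0 : ℝ) < p := by linarith
  have hR : ((p : ℝ) - 1) * padicValNat p m.factorial = m - (p.digits m).sum := by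
    have := congrArg (Nat.cast : ℕ → ℝ) h
    rw [Nat.cast_mul, Nat.cast_sub hs, Nat.cast_sub hpf.out.one_lt.le] at this
    simpa using this
  rw [auxPi, ← Real.rpow_natCast, ← Real.rpow_natCast, ← Real.rpow_mul hp0.le,
    ← Real.rpow_add hp0, ← Real.rpow_neg hp0.le]
  congr 1
  have : (p : ℝ) - 1 ≠ 0 := by linarith
  field_simp
  linarith

lemma auxPi_pos : 0 < auxPi p := Real.rpow_pos_of_pos (by exact_mod_cast hpf.out.pos) _

lemma aux_fact_lower (hp : ‖(p : L)‖ = (p : ℝ)⁻¹) (m : ℕ) :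
    auxPi p ^ m ≤ ‖(m.factorial : L)‖ := by
  rw [aux_fact p hp]
  have hp1 : (1 : ℝ) < p := by exact_mod_cast hpf.out.one_lt
  have h1 := auxPi_pos p
  have : (1 : ℝ) ≤ (p : ℝ) ^ (((p.digits m).sum : ℝ) / ((p : ℝ) - 1)) :=
    Real.one_le_rpow hp1.le (div_nonneg (by positivity) (by linarith))
  exact le_mul_of_one_le_right (by positivity) this

lemma aux_fact_upper (hp : ‖(p : L)‖ = (p : ℝ)⁻¹) (m : ℕ) :
    ‖(m.factorial : L)‖ ≤ p * (m + 1) * auxPi p ^ m := by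
  rw [aux_fact p hp, mul_comm]
  have hp1 : (1 : ℝ) < p := by exact_mod_cast hpf.out.one_lt
  have h1 := auxPi_pos p
  gcongr
  have hs : (p.digits m).sum ≤ (p.digits m).length * (p - 1) := by
    have := List.sum_le_card_nsmul (p.digits m) (p - 1) (fun d hd => by
      have := Nat.digits_lt_base hpf.out.one_lt hd
      omega)
    simpa using this
  have hsR : ((p.digits m).sum : ℝ) / ((p : ℝ) - 1) ≤ (p.digits m).length := by
    rw [div_le_iff₀ (by linarith)]
    have : ((p.digits m).sum : ℝ) ≤ ((p.digits m).length * (p - 1) : ℕ) := by exact_mod_cast hs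
    rwa [Nat.cast_mul, Nat.cast_sub hpf.out.one_lt.le, Nat.cast_one] at this
  calc _ ≤ (p : ℝ) ^ ((p.digits m).length : ℝ) := Real.rpow_le_rpow_of_exponent_le hp1.le hsR
    _ = (p : ℝ) ^ ((p.digits m).length) := Real.rpow_natCast _ _
    _ ≤ p * (m + 1) := by
      rcases Nat.eq_zero_or_pos m with rfl | hm
      · simpa using hpf.out.one_lt.le
      · rw [Nat.length_digits p m hpf.out.one_lt hm.ne', pow_succ, mul_comm]
        have : p ^ Nat.log p m ≤ m := Nat.pow_log_le_self p hm.ne'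
        have : (p : ℝ) ^ Nat.log p m ≤ m := by exact_mod_cast this
        gcongr
        linarith

variable [CharZero L]

lemma aux_approx (hp : ‖(p : L)‖ = (p : ℝ)⁻¹) (g : ℚ) (hg : ‖(g : L)‖ ≤ 1)
    (hz : ∀ z : ℤ, g ≠ z) : ∃ C : ℕ, ∀ K : ℕ, ∃ N : ℕ, N ≤ C * (K + 1) ∧
      ∀ k ≤ K, ‖(g : L) + k‖ = ‖((N + k : ℕ) : L)‖ := by
  have hpp := hpf.out
  have hp1 : (1 : ℝ) < p := by exact_mod_cast hpp.one_lt
  have hb0 : (g.den : L) ≠ 0 := by exact_mod_cast g.den_nz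
  have hgd : (g : L) * g.den = g.num := by exact_mod_cast congrArg (Rat.cast : ℚ → L) (Rat.mul_den_eq_num g)
  have hb : ¬ p ∣ g.den := by
    intro hd
    have ha : ¬ p ∣ g.num.natAbs := fun h =>
      hpp.one_lt.ne' (Nat.eq_one_of_dvd_coprimes g.reduced h hd)
    have h1 : ‖(g.num : L)‖ = 1 := by
      have := aux_coprime p hp _ ha
      rcases Int.natAbs_eq g.num with h | h
      · rw [h]; simpa using this
      · rw [h]; simpa using this
    have h2 : ‖(g.den : L)‖ < 1 := by
      obtain ⟨c, hc⟩ := hd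
      rw [hc, Nat.cast_mul, norm_mul, hp]
      have := IsUltrametricDist.norm_natCast_le_one L c
      calc _ ≤ (p : ℝ)⁻¹ * 1 := by gcongr
        _ < 1 := by rw [mul_one]; exact inv_lt_one_of_one_lt₀ hp1
    rw [← hgd, norm_mul] at h1
    have := mul_le_of_le_one_left (norm_nonneg (g.den : L)) hg
    linarith
  have hbn : ‖(g.den : L)‖ = 1 := aux_coprime p hp _ hb
  refine ⟨p * (g.num.natAbs + g.den), fun K => ?_⟩
  set X := g.num.natAbs + K * g.den with hX
  have hX0 : X ≠ 0 := by
    have : g.num ≠ 0 := fun h => hz 0 (by simpa using h)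
    omega
  set M := Nat.log p X + 1 with hM
  have hXM : X < p ^ M := Nat.lt_pow_succ_log_self hpp.one_lt X
  have hMX : p ^ M ≤ p * X := by
    rw [hM, pow_succ, mul_comm]
    exact Nat.mul_le_mul_left _ (Nat.pow_log_le_self p hX0)
  have hpM : 0 < p ^ M := pow_pos hpp.pos _
  have hcop : IsCoprime (g.den : ℤ) ((p ^ M : ℕ) : ℤ) :=
    Nat.isCoprime_iff_coprime.2 (Nat.Coprime.pow_right _ ((Nat.Prime.coprime_iff_not_dvd hpp).2 hb).symm)
  obtain ⟨u, v, huv⟩ := hcop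
  set N0 : ℤ := (u * g.num) % ((p ^ M : ℕ) : ℤ) with hN0
  have hN0n : 0 ≤ N0 := Int.emod_nonneg _ (by exact_mod_cast hpM.ne')
  have hN0l : N0 < ((p ^ M : ℕ) : ℤ) := Int.emod_lt_of_pos _ (by exact_mod_cast hpM)
  have hdvd : ((p ^ M : ℕ) : ℤ) ∣ g.den * N0 - g.num := by
    have h1 : u * g.num = N0 + ((p ^ M : ℕ) : ℤ) * ((u * g.num) / ((p ^ M : ℕ) : ℤ)) :=
      (Int.emod_add_mul_ediv _ _).symm
    refine ⟨-(g.den * ((u * g.num) / ((p ^ M : ℕ) : ℤ))) - v * g.num, ?_⟩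
    linear_combination (-g.den : ℤ) * h1 + g.num * huv
  obtain ⟨N, hN⟩ := Int.eq_ofNat_of_zero_le hN0n
  refine ⟨N, ?_, fun k hk => ?_⟩
  · have : N ≤ p ^ M := by
      have := hN0l.le
      rw [hN] at this
      exact_mod_cast this
    refine this.trans (hMX.trans ?_)
    rw [mul_assoc]
    refine Nat.mul_le_mul_left _ ?_
    rw [hX]
    generalize g.num.natAbs = a
    nlinarith [Nat.zero_le (a * K), Nat.zero_le g.den]
  · obtain ⟨c, hc⟩ := hdvd
    rw [hN] at hc
    have hcL : (g.den : L) * N - g.num = (p : L) ^ M * c := by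
      exact_mod_cast congrArg (Int.cast : ℤ → L) hc
    have e1 : ((g : L) + k) * g.den = ((g.num + k * g.den : ℤ) : L) := by
      push_cast; rw [← hgd]; ring
    have e2 : ((N + k : ℕ) : L) * g.den = ((g.num + k * g.den : ℤ) : L) + (p : L) ^ M * c := by
      rw [← hcL]; push_cast; ring
    have hz0 : g.num + k * g.den ≠ 0 := by
      intro h
      apply hz (-k)
      have : g * g.den = g.num := Rat.mul_den_eq_num g
      have h' : (g.num : ℚ) + k * g.den = 0 := by exact_mod_cast h
      have hd : (g.den : ℚ) ≠ 0 := by exact_mod_cast g.den_nz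
      apply mul_right_cancel₀ hd
      push_cast
      linarith
    have hlow := aux_int_lower (L := L) p hp _ hz0
    have hnat : (g.num + k * g.den : ℤ).natAbs ≤ X := by
      have h1 := Int.natAbs_add_le g.num (k * g.den)
      have h2 : ((k : ℤ) * g.den).natAbs = k * g.den := by exact_mod_cast Int.natAbs_natCast (k * g.den)
      rw [h2] at h1
      have : k * g.den ≤ K * g.den := Nat.mul_le_mul_right _ hk
      omega
    have hlt : ‖(p : L) ^ M * c‖ < ‖((g.num + k * g.den : ℤ) : L)‖ := by
      refine lt_of_lt_of_le ?_ hlow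
      rw [norm_mul, norm_pow, hp]
      have := IsUltrametricDist.norm_intCast_le_one L c
      have hpos : (0 : ℝ) < (g.num + k * g.den : ℤ).natAbs := by
        exact_mod_cast Int.natAbs_pos.2 hz0
      have h5 : ((g.num + k * g.den : ℤ).natAbs : ℝ) < (p : ℝ) ^ M := by
        exact_mod_cast lt_of_le_of_lt hnat hXM
      calc _ ≤ (p : ℝ)⁻¹ ^ M * 1 := by gcongr
        _ = ((p : ℝ) ^ M)⁻¹ := by rw [mul_one, inv_pow]
        _ < _ := by gcongr
    have h6 : ‖((g.num + k * g.den : ℤ) : L) + (p : L) ^ M * c‖ = ‖((g.num + k * g.den : ℤ) : L)‖ := by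
      rw [IsUltrametricDist.norm_add_eq_max_of_norm_ne_norm hlt.ne', max_eq_left hlt.le]
    rw [← e2, ← e1, norm_mul, norm_mul, hbn, mul_one, mul_one] at h6
    exact h6.symm

lemma aux_prod_nat (N n m : ℕ) :
    ∏ k ∈ Finset.range m, ((N + (n + 1 + k) : ℕ)) = m.factorial * (N + n + m).choose m := by
  rw [← Nat.ascFactorial_eq_factorial_mul_choose, Nat.ascFactorial_eq_prod_range]
  exact Finset.prod_congr rfl fun k _ => by ring

lemma aux_prod_upper (hp : ‖(p : L)‖ = (p : ℝ)⁻¹) (g : ℚ) (hg : ‖(g : L)‖ ≤ 1)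
    (hz : ∀ z : ℤ, g ≠ z) (n m : ℕ) :
    ‖∏ k ∈ Finset.range m, ((g : L) + ((n + 1 + k : ℕ) : L))‖ ≤ p * (m + 1) * auxPi p ^ m := by
  obtain ⟨C, hC⟩ := aux_approx p hp g hg hz
  obtain ⟨N, -, hN⟩ := hC (n + m)
  refine le_trans ?_ (aux_fact_upper (L := L) p hp m)
  rw [norm_prod, Finset.prod_congr rfl fun k hk => hN (n + 1 + k) (by
    have := Finset.mem_range.1 hk; omega), ← norm_prod, ← Nat.cast_prod, aux_prod_nat,
    Nat.cast_mul, norm_mul]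
  exact mul_le_of_le_one_right (norm_nonneg _) (IsUltrametricDist.norm_natCast_le_one L _)

lemma aux_prod_lower (hp : ‖(p : L)‖ = (p : ℝ)⁻¹) (g : ℚ) (hg : ‖(g : L)‖ ≤ 1)
    (hz : ∀ z : ℤ, g ≠ z) : ∃ c : ℝ, 0 < c ∧ ∀ m : ℕ,
    c * ((m : ℝ) + 1)⁻¹ * auxPi p ^ m ≤ ‖∏ k ∈ Finset.range m, ((g : L) + ((k + 1 : ℕ) : L))‖ := by
  obtain ⟨C, hC⟩ := aux_approx p hp g hg hz
  refine ⟨((C : ℝ) + 1)⁻¹, by positivity, fun m => ?_⟩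
  obtain ⟨N, hNC, hN⟩ := hC m
  rw [norm_prod, Finset.prod_congr rfl fun k hk => hN (k + 1) (by
    have := Finset.mem_range.1 hk; omega), ← norm_prod, ← Nat.cast_prod]
  have := aux_prod_nat N 0 m
  rw [Finset.prod_congr rfl fun k _ => show N + (k + 1) = N + (0 + 1 + k) by ring, this,
    Nat.cast_mul, norm_mul, mul_comm]
  have h1 := aux_fact_lower (L := L) p hp m
  have h0 := auxPi_pos p
  refine mul_le_mul h1 ?_ (by positivity) (norm_nonneg _)
  have hch : (N + 0 + m).choose m ≠ 0 := (Nat.choose_pos (by omega)).ne'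
  rw [aux_norm_nat p hp _ hch, ← mul_inv]
  have hle : p ^ padicValNat p ((N + 0 + m).choose m) ≤ (C + 1) * (m + 1) := by
    rw [← Nat.factorization_def _ hpf.out]
    rcases Nat.eq_zero_or_pos (N + m) with h | h
    · have : N = 0 ∧ m = 0 := by omega
      simp [this.1, this.2]
    · refine (Nat.pow_factorization_choose_le (n := N + 0 + m) (k := m) (by omega)).trans ?_
      nlinarith
  have hle' : (p : ℝ) ^ padicValNat p ((N + 0 + m).choose m) ≤ (C + 1) * (m + 1) := by
    exact_mod_cast hle
  have hp0 : (0 : ℝ) < p := by exact_mod_cast hpf.out.pos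
  gcongr
end

section
variable (p : ℕ) [hpf : Fact p.Prime] {L : Type*} [NontriviallyNormedField L]

lemma aux_entry_le {m : Type*} [Fintype m] [Nonempty m] (Y : Matrix m m L) (i j : m) :
    ‖Y i j‖ ≤ matMaxNorm Y :=
  (Finset.le_sup' (fun j => ‖Y i j‖) (Finset.mem_univ j)).trans
    (Finset.le_sup' (fun i : m => Finset.univ.sup' Finset.univ_nonempty (fun j : m => ‖Y i j‖))
      (Finset.mem_univ i))

lemma aux_le_of_entry {m : Type*} [Fintype m] [Nonempty m] (Y : Matrix m m L) (B : ℝ)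
    (h : ∀ i j, ‖Y i j‖ ≤ B) : matMaxNorm Y ≤ B :=
  Finset.sup'_le _ _ fun i _ => Finset.sup'_le _ _ fun j _ => h i j

variable [IsUltrametricDist L] [CharZero L] {ι : Type*} [Fintype ι] [DecidableEq ι]

lemma aux_upProd_comm (X A : Matrix ι ι L) (h : Commute A X) (n : ℕ) : Commute A (upProd X n) := by
  induction n with
  | zero => exact Commute.one_right A
  | succ n ih =>
    exact Commute.mul_right (h.add_right ((Commute.one_right A).smul_right _)) ih

open Polynomial in
lemma aux_upper (hp : ‖(p : L)‖ = (p : ℝ)⁻¹) (X : Matrix ι ι L) (s : Multiset ℚ) :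
    ∀ (_ : ∀ g ∈ s, ‖(g : L)‖ ≤ 1 ∧ ∀ z : ℤ, g ≠ z) (W : Matrix ι ι L)
      (_ : aeval X (s.map fun g : ℚ => (Polynomial.X - C (g : L) : L[X])).prod * W = 0),
      ∃ (C : ℝ) (d : ℕ), 0 < C ∧ ∀ n i j, ‖(upProd X n * W) i j‖ ≤ C * ((n : ℝ) + 1) ^ d * auxPi p ^ n := by
  have hπ := auxPi_pos p
  have hp0 : (0 : ℝ) < p := by exact_mod_cast hpf.out.pos
  induction s using Multiset.induction_on with
  | empty =>
    intro _ W hW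
    refine ⟨1, 0, one_pos, fun n i j => ?_⟩
    have : W = 0 := by simpa using hW
    rw [this]
    simp
    positivity
  | cons g s ih =>
    intro hs W hW
    obtain ⟨hg, hz⟩ := hs g (Multiset.mem_cons_self _ _)
    obtain ⟨C', d, hC', hB⟩ := ih (fun g hg => hs g (Multiset.mem_cons_of_mem hg))
      ((X - (g : L) • 1) * W) (by
        rw [Multiset.map_cons, Multiset.prod_cons, mul_comm, map_mul, Matrix.mul_assoc] at hW
        rw [← hW]
        simp [Algebra.algebraMap_eq_smul_one])
    obtain ⟨w, hw0, hw⟩ : ∃ w : ℝ, 0 < w ∧ ∀ i j, ‖W i j‖ ≤ w := by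
      refine ⟨1 + ∑ i, ∑ j, ‖W i j‖, by positivity, fun i j => ?_⟩
      have h1 : ‖W i j‖ ≤ ∑ j, ‖W i j‖ :=
        Finset.single_le_sum (f := fun j => ‖W i j‖) (fun _ _ => norm_nonneg _) (Finset.mem_univ j)
      have h2 : ∑ j, ‖W i j‖ ≤ ∑ i, ∑ j, ‖W i j‖ :=
        Finset.single_le_sum (f := fun i => ∑ j, ‖W i j‖)
          (fun _ _ => Finset.sum_nonneg fun _ _ => norm_nonneg _) (Finset.mem_univ i)
      linarith
    set D : ℝ := p * w + C' * p / auxPi p with hD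
    have hDpos : 0 < D := by positivity
    have key : ∀ n m : ℕ, ∀ i j,
        ‖(∏ k ∈ Finset.range m, ((g : L) + ((n + 1 + k : ℕ) : L))) * (upProd X n * W) i j‖ ≤
          D * ((n : ℝ) + m + 1) ^ (d + 1) * auxPi p ^ (n + m) := by
      intro n
      induction n with
      | zero =>
        intro m i j
        have h1 := aux_prod_upper p hp g hg hz 0 m
        rw [norm_mul]
        have h2 : ‖(upProd X 0 * W) i j‖ ≤ w := by simpa [upProd] using hw i j
        have hle : ((m : ℝ) + 1) ≤ (m + 1) ^ (d + 1) := le_self_pow₀ (by linarith [(Nat.cast_nonneg m : (0:ℝ) ≤ m)]) (by omega)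
        have hDw : p * w ≤ D := by rw [hD]; have : 0 < C' * p / auxPi p := by positivity
                                   linarith
        calc _ ≤ (p * (m + 1) * auxPi p ^ m) * w := by gcongr
          _ = (p * w) * (m + 1) * auxPi p ^ m := by ring
          _ ≤ D * (m + 1) ^ (d + 1) * auxPi p ^ m := by gcongr
          _ = _ := by simp
      | succ n ihn =>
        intro m i j
        have e : upProd X (n + 1) * W = ((g : L) + ((n + 1 : ℕ) : L)) • (upProd X n * W)
            + upProd X n * ((X - (g : L) • 1) * W) := by
          have hc : X * upProd X n = upProd X n * X := aux_upProd_comm X X (Commute.refl X) n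
          simp only [upProd]
          rw [add_mul, hc]
          simp only [add_mul, mul_sub, sub_mul, Matrix.mul_assoc, Matrix.smul_mul, Matrix.mul_smul,
            Matrix.one_mul, Matrix.mul_one, add_smul, Nat.cast_add, Nat.cast_one, one_smul]
          abel
        rw [e, Matrix.add_apply, Matrix.smul_apply, smul_eq_mul, mul_add]
        refine (IsUltrametricDist.norm_add_le_max _ _).trans (max_le ?_ ?_)
        · have := ihn (m + 1) i j
          rw [Finset.prod_range_succ'] at this
          have hh : ∀ k, n + 1 + (k + 1) = n + 1 + 1 + k := fun k => by ring
          rw [Finset.prod_congr rfl fun k _ => by rw [hh k]] at this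
          rw [add_zero, mul_assoc] at this
          refine this.trans (le_of_eq ?_)
          push_cast
          ring
        · rw [norm_mul]
          have h1 := aux_prod_upper p hp g hg hz (n + 1) m
          have h2 := hB n i j
          have hn : (0 : ℝ) ≤ n := Nat.cast_nonneg n
          have hm : (0 : ℝ) ≤ m := Nat.cast_nonneg m
          have hDw : C' * p / auxPi p ≤ D := by
            rw [hD]; have : 0 < p * w := by positivity
            linarith
          calc _ ≤ (p * (m + 1) * auxPi p ^ m) * (C' * ((n : ℝ) + 1) ^ d * auxPi p ^ n) := by gcongr
            _ = (C' * p / auxPi p) * (((n : ℝ) + 1) ^ d * (m + 1)) * auxPi p ^ (n + 1 + m) := by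
              field_simp
              ring
            _ ≤ D * (((n : ℝ) + 1 + m + 1) ^ d * (n + 1 + m + 1)) * auxPi p ^ (n + 1 + m) := by
              gcongr <;> linarith
            _ = _ := by push_cast; ring
    refine ⟨D, d + 1, hDpos, fun n i j => ?_⟩
    simpa using key n 0 i j

lemma aux_eig (X : Matrix ι ι L) (g : L) (x : ι → L) (hx : X.mulVec x = g • x) (n : ℕ) :
    (upProd X n).mulVec x = (∏ k ∈ Finset.range n, (g + ((k + 1 : ℕ) : L))) • x := by
  induction n with
  | zero => simp [upProd]
  | succ n ih =>
    rw [upProd, ← Matrix.mulVec_mulVec, ih, Matrix.mulVec_smul, Matrix.add_mulVec, hx,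
      Matrix.smul_mulVec, Matrix.one_mulVec, Finset.prod_range_succ, ← add_smul, smul_smul]
    push_cast
    rfl

end

lemma aux_lim (C : ℝ) (hC : 0 < C) (d : ℤ) :
    Tendsto (fun n : ℕ => (C * ((n : ℝ) + 1) ^ d) ^ ((1 : ℝ) / n)) atTop (nhds 1) := by
  have h1 : Tendsto (fun n : ℕ => C ^ ((1 : ℝ) / n)) atTop (nhds 1) := by
    have := (tendsto_const_nhds (x := C)).rpow tendsto_one_div_atTop_nhds_zero_nat (Or.inl hC.ne')
    simpa using this
  have h2 : Tendsto (fun n : ℕ => ((n : ℝ) + 1) ^ ((d : ℝ) / n)) atTop (nhds 1) := by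
    have := (tendsto_rpow_div_mul_add d 1 (-1) (by norm_num)).comp
      (tendsto_atTop_add_const_right atTop (1 : ℝ) tendsto_natCast_atTop_atTop : Tendsto (fun n : ℕ => (n : ℝ) + 1) atTop atTop)
    refine this.congr fun n => ?_
    simp
  have := h1.mul h2
  rw [one_mul] at this
  refine this.congr fun n => ?_
  rw [Real.mul_rpow hC.le (by positivity), ← Real.rpow_intCast, ← Real.rpow_mul (by positivity)]
  congr 2
  ring

/-- Let `v` be a place above `p` of a number field (modelled by a non-archimedean
normed field `L` of characteristic `0` with `‖p‖ = p⁻¹`), `τ ∈ L` nonzero, and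
`Λ ∈ GL_ν(ℚ)` with all eigenvalues in `ℚ ∩ ℤ_p \ ℤ`. Then
`lim_{n→∞} ‖C_{Λ,τ}(n)‖_v^{1/n} = |τ|_v⁻¹ p^{-1/(p-1)}`. -/
theorem Cmat_pos_norm_root_tendsto
    (p : ℕ) [Fact p.Prime] {L : Type*} [NontriviallyNormedField L] [CharZero L]
    (hna : ∀ x y : L, ‖x + y‖ ≤ max ‖x‖ ‖y‖) (hp : ‖(p : L)‖ = (p : ℝ)⁻¹)
    (τ : L) (hτ : τ ≠ 0) (ν : ℕ) [NeZero ν]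
    (Λ : Matrix (Fin ν) (Fin ν) ℚ) (hΛ : IsUnit Λ.det) (γ : Fin ν → ℚ)
    (hcp : Λ.charpoly = ∏ j, (Polynomial.X - Polynomial.C (γ j)))
    (hint : ∀ j, ‖((γ j : ℚ) : L)‖ ≤ 1) (hnotZ : ∀ j, ∀ z : ℤ, γ j ≠ (z : ℚ)) :
    Tendsto
      (fun n : ℕ =>
        matMaxNorm (τ⁻¹ ^ n • upProd (Λ.map (fun q : ℚ => (q : L))) n) ^ ((1 : ℝ) / n))
      atTop (nhds (‖τ‖⁻¹ * (p : ℝ) ^ (-(1 : ℝ) / ((p : ℝ) - 1)))) := by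
  haveI : IsUltrametricDist L :=
    IsUltrametricDist.isUltrametricDist_of_forall_norm_add_le_max_norm hna
  set X : Matrix (Fin ν) (Fin ν) L := Λ.map (fun q : ℚ => (q : L)) with hX
  have hcpL : X.charpoly = ∏ j, (Polynomial.X - Polynomial.C ((γ j : ℚ) : L)) := by
    have h := Matrix.charpoly_map Λ (Rat.castHom L)
    rw [hcp, Polynomial.map_prod] at h
    simpa using h
  have hπ := auxPi_pos p
  have hτn : 0 < ‖τ‖ := norm_pos_iff.2 hτ
  -- upper bound
  obtain ⟨C, d, hC, hup⟩ := aux_upper p hp X (Finset.univ.val.map γ)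
    (by
      intro g hg
      obtain ⟨j, -, rfl⟩ := Multiset.mem_map.1 hg
      exact ⟨hint j, hnotZ j⟩) 1
    (by
      rw [Multiset.map_map, mul_one]
      have h := Matrix.aeval_self_charpoly X
      rw [hcpL] at h
      exact h)
  -- lower bound
  obtain ⟨c, hc, hlow⟩ : ∃ c : ℝ, 0 < c ∧ ∀ n : ℕ,
      c * ((n : ℝ) + 1)⁻¹ * auxPi p ^ n ≤ matMaxNorm (upProd X n) := by
    have hdet : (((γ 0 : ℚ) : L) • (1 : Matrix (Fin ν) (Fin ν) L) - X).det = 0 := by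
      have h := Matrix.eval_charpoly X ((γ 0 : ℚ) : L)
      rw [hcpL, Polynomial.eval_prod, Finset.prod_eq_zero (Finset.mem_univ 0) (by simp)] at h
      rw [h, Matrix.smul_one_eq_diagonal]
      rfl
    obtain ⟨x, hx0, hx⟩ := Matrix.exists_mulVec_eq_zero_iff.2 hdet
    have hx' : X.mulVec x = ((γ 0 : ℚ) : L) • x := by
      rw [Matrix.sub_mulVec, Matrix.smul_mulVec, Matrix.one_mulVec, sub_eq_zero] at hx
      exact hx.symm
    obtain ⟨i, hi⟩ := Function.ne_iff.1 hx0
    have hi' : 0 < ‖x i‖ := norm_pos_iff.2 hi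
    have hS : 0 < ∑ j, ‖x j‖ := lt_of_lt_of_le hi'
      (Finset.single_le_sum (f := fun j => ‖x j‖) (fun _ _ => norm_nonneg _) (Finset.mem_univ i))
    obtain ⟨c, hc, hlow⟩ := aux_prod_lower p hp (γ 0) (hint 0) (hnotZ 0)
    refine ⟨c * (‖x i‖ / ∑ j, ‖x j‖), by positivity, fun n => ?_⟩
    have h1 := congrFun (aux_eig X _ x hx' n) i
    have h2 : ‖(upProd X n).mulVec x i‖ ≤ matMaxNorm (upProd X n) * ∑ j, ‖x j‖ := by
      rw [Matrix.mulVec, dotProduct, Finset.mul_sum]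
      refine (norm_sum_le _ _).trans (Finset.sum_le_sum fun j _ => ?_)
      rw [norm_mul]
      exact mul_le_mul_of_nonneg_right (aux_entry_le _ i j) (norm_nonneg _)
    rw [h1, Pi.smul_apply, smul_eq_mul, norm_mul] at h2
    have h3 := mul_le_mul_of_nonneg_right (hlow n) hi'.le
    have h4 := (div_le_iff₀ hS).2 (h3.trans h2)
    refine le_trans (le_of_eq ?_) h4
    ring
  have hsm : ∀ n, matMaxNorm (τ⁻¹ ^ n • upProd X n) = ‖τ‖⁻¹ ^ n * matMaxNorm (upProd X n) := by
    intro n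
    apply le_antisymm
    · refine aux_le_of_entry _ _ fun i j => ?_
      rw [Matrix.smul_apply, smul_eq_mul, norm_mul, norm_pow, norm_inv]
      exact mul_le_mul_of_nonneg_left (aux_entry_le _ i j) (by positivity)
    · have hpos : 0 < ‖τ‖⁻¹ ^ n := by positivity
      rw [mul_comm, ← le_div_iff₀ hpos]
      refine aux_le_of_entry _ _ fun i j => ?_
      rw [le_div_iff₀ hpos]
      refine le_trans (le_of_eq ?_) (aux_entry_le _ i j)
      rw [Matrix.smul_apply, smul_eq_mul, norm_mul, norm_pow, norm_inv, mul_comm]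
  set ρ : ℝ := ‖τ‖⁻¹ * auxPi p with hρ
  have hρ0 : 0 < ρ := by positivity
  change Tendsto _ atTop (nhds ρ)
  have hroot : ∀ n : ℕ, n ≠ 0 → ∀ y : ℝ, 0 ≤ y →
      y ^ ((1 : ℝ) / n) * ρ = (‖τ‖⁻¹ ^ n * (y * auxPi p ^ n)) ^ ((1 : ℝ) / n) := by
    intro n hn y hy
    rw [show ‖τ‖⁻¹ ^ n * (y * auxPi p ^ n) = y * ρ ^ n by rw [hρ, mul_pow]; ring,
      Real.mul_rpow hy (by positivity), one_div, Real.pow_rpow_inv_natCast hρ0.le hn]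
  have l1 := (aux_lim c hc (-1)).mul_const ρ
  have l2 := (aux_lim C hC d).mul_const ρ
  rw [one_mul] at l1 l2
  refine tendsto_of_tendsto_of_tendsto_of_le_of_le' l1 l2 ?_ ?_
  · filter_upwards [eventually_ne_atTop 0] with n hn
    rw [hroot n hn _ (by positivity), hsm]
    refine Real.rpow_le_rpow (by positivity) ?_ (by positivity)
    refine mul_le_mul_of_nonneg_left ?_ (by positivity)
    simpa using hlow n
  · filter_upwards [eventually_ne_atTop 0] with n hn
    rw [hroot n hn _ (by positivity), hsm]
    have h0 : 0 ≤ matMaxNorm (upProd X n) := (norm_nonneg _).trans (aux_entry_le (upProd X n) 0 0)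
    refine Real.rpow_le_rpow (by positivity) ?_ (by positivity)
    refine mul_le_mul_of_nonneg_left ?_ (by positivity)
    refine aux_le_of_entry _ _ fun i j => ?_
    simpa using hup n i j
end

section
/- Under the same hypotheses (Λ ∈ GL_ν(ℚ) with all eigenvalues in ℚ ∩ ℤ_p \ ℤ, τ ≠ 0), lim_{n→+∞} ‖C_{Λ,τ}(-n)‖_v^{1/n} = |τ|_v · p^{1/(p-1)}, where C_{Λ,τ}(-n) = τ^{n}Λ^{-1}(Λ-I)^{-1}⋯(Λ-(n-1)I)^{-1} for n ≥ 1. -/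
open Filter

section

variable {K : Type*} [Field K] {ι : Type*} [Fintype ι] [DecidableEq ι]

/-- `downProd Λ n = Λ⁻¹ (Λ - I)⁻¹ ⋯ (Λ - (n-1)I)⁻¹`. -/
noncomputable def downProd (Λ : Matrix ι ι K) : ℕ → Matrix ι ι K
  | 0 => 1
  | m + 1 => downProd Λ m * (Λ - (m : K) • (1 : Matrix ι ι K))⁻¹

end

theorem aux_norm_coprime (p : ℕ) [hpf : Fact p.Prime] {L : Type*} [NormedField L]
    [IsUltrametricDist L] (hp : ‖(p : L)‖ = (p : ℝ)⁻¹) (m : ℕ) (hm : ¬ p ∣ m) : ‖(m : L)‖ = 1 := by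
  apply le_antisymm (IsUltrametricDist.norm_natCast_le_one L m)
  have hc : IsCoprime (m : ℤ) (p : ℤ) :=
    Nat.isCoprime_iff_coprime.mpr ((Nat.Prime.coprime_iff_not_dvd hpf.out).mpr hm).symm
  obtain ⟨u, v, huv⟩ := hc
  have h1 : (u : L) * m + v * p = 1 := by exact_mod_cast congrArg (Int.cast : ℤ → L) huv
  have h2 := IsUltrametricDist.norm_add_le_max ((u : L) * m) (v * p)
  rw [h1, norm_one, norm_mul, norm_mul, hp] at h2
  have hu := IsUltrametricDist.norm_intCast_le_one L u
  have hv := IsUltrametricDist.norm_intCast_le_one L v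
  have hpp : (p : ℝ)⁻¹ < 1 := inv_lt_one_of_one_lt₀ (by exact_mod_cast hpf.out.one_lt)
  have hp0 : 0 ≤ (p : ℝ)⁻¹ := by positivity
  rcases le_max_iff.mp h2 with h | h
  · nlinarith [norm_nonneg (m : L)]
  · nlinarith

theorem aux_norm_nat_s12 (p : ℕ) [hpf : Fact p.Prime] {L : Type*} [NormedField L]
    [IsUltrametricDist L] (hp : ‖(p : L)‖ = (p : ℝ)⁻¹) (m : ℕ) (hm : m ≠ 0) :
    ‖(m : L)‖ = ((p : ℝ) ^ (padicValNat p m))⁻¹ := by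
  obtain ⟨e, m', h, rfl⟩ := Nat.exists_eq_pow_mul_and_not_dvd hm p hpf.out.ne_one
  have hm' : m' ≠ 0 := by rintro rfl; simp at h
  rw [padicValNat.mul (pow_ne_zero _ hpf.out.ne_zero) hm', padicValNat.prime_pow,
    padicValNat.eq_zero_of_not_dvd h]
  push_cast
  rw [norm_mul, norm_pow, aux_norm_coprime p hp m' h, hp]
  simp

theorem aux_norm_int_lower (p : ℕ) [hpf : Fact p.Prime] {L : Type*} [NormedField L]
    [IsUltrametricDist L] (hp : ‖(p : L)‖ = (p : ℝ)⁻¹) (m : ℤ) (hm : m ≠ 0) :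
    (m.natAbs : ℝ)⁻¹ ≤ ‖(m : L)‖ := by
  have h1 : ‖(m : L)‖ = ‖(m.natAbs : L)‖ := by
    rcases Int.natAbs_eq m with h | h
    · conv_lhs => rw [h]
      simp
    · conv_lhs => rw [h]
      simp
  have h0 : m.natAbs ≠ 0 := by simpa using hm
  rw [h1, aux_norm_nat_s12 p hp _ h0]
  apply inv_anti₀
  · exact pow_pos (by exact_mod_cast hpf.out.pos) _
  · exact_mod_cast Nat.le_of_dvd (Nat.pos_of_ne_zero h0) pow_padicValNat_dvd

theorem aux_factorial (p : ℕ) [hpf : Fact p.Prime] {L : Type*} [NormedField L]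
    [IsUltrametricDist L] (hp : ‖(p : L)‖ = (p : ℝ)⁻¹) (R : ℝ) (hR1 : 1 ≤ R)
    (hR : R ^ (p - 1) = p) (n : ℕ) :
    (R ^ n)⁻¹ ≤ ‖(n.factorial : L)‖ ∧
      ‖(n.factorial : L)‖ ≤ p * (n + 1) * (R ^ n)⁻¹ := by
  have hR0 : 0 < R := by linarith
  have hpR : (1 : ℝ) ≤ p := by exact_mod_cast hpf.out.one_le
  rw [aux_norm_nat_s12 p hp _ n.factorial_ne_zero]
  have h1 := sub_one_mul_padicValNat_factorial (p := p) n
  set s := (p.digits n).sum with hs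
  have hsn : s ≤ n := Nat.digit_sum_le p n
  have h2 : R ^ n = (p : ℝ) ^ (padicValNat p n.factorial) * R ^ s := by
    rw [← hR, ← pow_mul, h1, ← pow_add, Nat.sub_add_cancel hsn]
  have hP : 0 < (p : ℝ) ^ (padicValNat p n.factorial) := by positivity
  have hs1 : R ^ s ≤ p * (n + 1) := by
    have h3 : s ≤ (p - 1) * (p.digits n).length := by
      have := List.sum_le_card_nsmul (p.digits n) (p - 1) (fun x hx => by
        have := Nat.digits_lt_base hpf.out.one_lt hx
        omega)
      simpa [mul_comm] using this
    calc R ^ s ≤ R ^ ((p - 1) * (p.digits n).length) := pow_le_pow_right₀ hR1 h3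
      _ = (p : ℝ) ^ (p.digits n).length := by rw [pow_mul, hR]
      _ ≤ p * (n + 1) := by
        rcases Nat.eq_zero_or_pos n with rfl | hn
        · simpa using hpR
        · have h4 := Nat.base_pow_length_digits_le p n hpf.out.one_lt hn.ne'
          have h5 : (p : ℝ) ^ (p.digits n).length ≤ p * n := by exact_mod_cast h4
          nlinarith
  constructor
  · rw [h2]
    apply inv_anti₀ hP
    exact le_mul_of_one_le_right hP.le (one_le_pow₀ hR1)
  · rw [h2, mul_inv, inv_eq_one_div, mul_comm, mul_assoc]
    rw [div_le_iff₀ hP]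
    have : (1 / (p : ℝ) ^ padicValNat p n.factorial * ((R ^ s)⁻¹ * (p * (n + 1)))) * (p : ℝ) ^ padicValNat p n.factorial = (R ^ s)⁻¹ * (p * (n + 1)) := by
      field_simp
    rw [this, ← div_eq_inv_mul, le_div_iff₀ (by positivity)]
    linarith

theorem aux_choose (p : ℕ) [hpf : Fact p.Prime] {L : Type*} [NormedField L]
    [IsUltrametricDist L] (hp : ‖(p : L)‖ = (p : ℝ)⁻¹) (N n : ℕ) (h : n ≤ N) :
    ((N : ℝ) + 1)⁻¹ ≤ ‖(N.choose n : L)‖ := by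
  rw [aux_norm_nat_s12 p hp _ (Nat.choose_pos h).ne']
  have hp0 : (0 : ℝ) < p := by exact_mod_cast hpf.out.pos
  apply inv_anti₀ (pow_pos hp0 _)
  have h1 := Nat.factorization_choose_le_log (p := p) (n := N) (k := n)
  rw [Nat.factorization_def _ hpf.out] at h1
  have h2 : p ^ (padicValNat p (N.choose n)) ≤ N + 1 := by
    refine (Nat.pow_le_pow_right hpf.out.pos h1).trans ?_
    rcases Nat.eq_zero_or_pos N with rfl | hN
    · simp
    · exact (Nat.pow_log_le_self p hN.ne').trans (by omega)
  exact_mod_cast h2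

theorem aux_approx_s12 (p : ℕ) [hpf : Fact p.Prime] (a : ℤ) (b : ℕ) (hb : ¬ p ∣ b) (I n : ℕ) :
    ∃ N : ℕ, n ≤ N ∧ N ≤ n + p ^ I ∧ ((p : ℤ) ^ I) ∣ a - N * b := by
  have hc : IsCoprime (b : ℤ) ((p : ℤ) ^ I) :=
    (Nat.isCoprime_iff_coprime.mpr ((Nat.Prime.coprime_iff_not_dvd hpf.out).mpr hb).symm).pow_right
  obtain ⟨u, v, huv⟩ := hc
  have hpos : (0 : ℤ) < (p : ℤ) ^ I := pow_pos (by exact_mod_cast hpf.out.pos) _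
  have hr0 := Int.emod_nonneg (u * a - n) hpos.ne'
  have hr1 := Int.emod_lt_of_pos (u * a - n) hpos
  have hdiv := Int.emod_add_mul_ediv (u * a - n) ((p : ℤ) ^ I)
  set r := (u * a - n) % (p : ℤ) ^ I with hr
  set q := (u * a - n) / (p : ℤ) ^ I
  refine ⟨n + r.toNat, by omega, ?_, ?_⟩
  · have : (r.toNat : ℤ) ≤ (p : ℤ) ^ I := by rw [Int.toNat_of_nonneg hr0]; exact hr1.le
    have : r.toNat ≤ p ^ I := by exact_mod_cast this
    omega
  · push_cast
    rw [Int.toNat_of_nonneg hr0]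
    refine ⟨a * v + b * q, ?_⟩
    linear_combination (-a) * huv + (-b : ℤ) * hdiv

theorem aux_c_bound (p : ℕ) [hpf : Fact p.Prime] {L : Type*} [NormedField L] [CharZero L]
    [IsUltrametricDist L] (hp : ‖(p : L)‖ = (p : ℝ)⁻¹) (R : ℝ) (hR1 : 1 ≤ R)
    (hR : R ^ (p - 1) = p) (γ : ℚ) (hint : ‖(γ : L)‖ ≤ 1) (hnotZ : ∀ z : ℤ, γ ≠ (z : ℚ)) :
    ∃ C : ℝ, 1 ≤ C ∧ ∀ n : ℕ,
      ‖∏ k ∈ Finset.range n, ((γ : L) - (k : L))‖ ≤ C * (n + 1) * (R ^ n)⁻¹ ∧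
      (R ^ n)⁻¹ ≤ C * (n + 1) * ‖∏ k ∈ Finset.range n, ((γ : L) - (k : L))‖ := by
  have hR0 : 0 < R := by linarith
  have hp1 : (1 : ℝ) ≤ p := by exact_mod_cast hpf.out.one_le
  have hbL : (γ.den : L) ≠ 0 := by exact_mod_cast γ.den_ne_zero
  have hγ : (γ : L) = (γ.num : L) / (γ.den : L) := Rat.cast_def γ
  have hb : ¬ p ∣ γ.den := by
    intro hd
    have hnd : ¬ p ∣ γ.num.natAbs := fun h =>
      Nat.Prime.not_coprime_iff_dvd.mpr ⟨p, hpf.out, h, hd⟩ γ.reduced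
    have h1 : ‖(γ.num : L)‖ = 1 := by
      rw [← aux_norm_coprime p hp _ hnd]
      rcases Int.natAbs_eq γ.num with h | h
      · conv_lhs => rw [h]
        simp
      · conv_lhs => rw [h]
        simp
    have h2 : ‖(γ.den : L)‖ < 1 := by
      obtain ⟨t, ht⟩ := hd
      rw [ht]
      push_cast
      rw [norm_mul, hp]
      have h3 := IsUltrametricDist.norm_natCast_le_one L t
      have : (p : ℝ)⁻¹ < 1 := inv_lt_one_of_one_lt₀ (by exact_mod_cast hpf.out.one_lt)
      nlinarith [norm_nonneg (t : L), show 0 ≤ (p : ℝ)⁻¹ by positivity]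
    rw [hγ, norm_div, h1, div_le_iff₀ (norm_pos_iff.mpr hbL)] at hint
    linarith
  have hb1 := aux_norm_coprime p hp _ hb
  set a := γ.num with ha
  set b := γ.den with hbdef
  set C0 := a.natAbs + b with hC0
  have hC0pos : 0 < C0 := by have := γ.den_pos; omega
  refine ⟨p * (2 + p * C0), ?_, ?_⟩
  · have : (0 : ℝ) ≤ p * C0 := by positivity
    nlinarith
  intro n
  set I := Nat.log p (C0 * (n + 1)) + 1 with hI
  have hI1 : C0 * (n + 1) < p ^ I := Nat.lt_pow_succ_log_self hpf.out.one_lt _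
  have hI2 : p ^ I ≤ p * (C0 * (n + 1)) := by
    rw [hI, pow_succ, mul_comm]
    exact Nat.mul_le_mul_left _ (Nat.pow_log_le_self p (by positivity))
  obtain ⟨N, hN1, hN2, hN3⟩ := aux_approx_s12 p a b hb I n
  have hsub : ∀ k : ℕ, ‖(γ : L) - k‖ = ‖((a - k * b : ℤ) : L)‖ := by
    intro k
    have : (γ : L) - k = ((a - k * b : ℤ) : L) / b := by
      rw [hγ]; push_cast; field_simp
    rw [this, norm_div, hb1, div_one]
  have hNγ : ‖(γ : L) - N‖ ≤ ((p : ℝ) ^ I)⁻¹ := by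
    rw [hsub]
    obtain ⟨t, ht⟩ := hN3
    rw [ht]
    push_cast
    rw [norm_mul, norm_pow, hp, inv_pow]
    exact mul_le_of_le_one_right (by positivity) (IsUltrametricDist.norm_intCast_le_one L t)
  have hk : ∀ k ∈ Finset.range n, ‖(γ : L) - k‖ = ‖((N - k : ℕ) : L)‖ := by
    intro k hk
    rw [Finset.mem_range] at hk
    have hne : a - k * b ≠ 0 := by
      intro h0
      apply hnotZ k
      rw [← Rat.num_div_den γ, ← ha, ← hbdef]
      have : (b : ℚ) ≠ 0 := by exact_mod_cast γ.den_ne_zero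
      rw [div_eq_iff this]
      have : a = k * b := by linarith
      rw [this]; push_cast; rfl
    have h1 := aux_norm_int_lower (L := L) p hp _ hne
    have h2 : (a - k * b : ℤ).natAbs ≤ C0 * (n + 1) := by
      have h3 := Int.natAbs_sub_le a (k * b)
      have h4 : ((k : ℤ) * b).natAbs = k * b := by
        rw [Int.natAbs_mul]; simp
      rw [h4] at h3
      refine h3.trans ?_
      rw [hC0]
      have : k * b ≤ n * b := Nat.mul_le_mul_right _ hk.le
      nlinarith [Nat.zero_le (a.natAbs * n), Nat.zero_le b]
    have h5 : ‖(γ : L) - N‖ < ‖(γ : L) - k‖ := by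
      rw [hsub k]
      refine lt_of_le_of_lt hNγ (lt_of_lt_of_le ?_ h1)
      apply inv_strictAnti₀
      · have : 0 < (a - k * b : ℤ).natAbs := Int.natAbs_pos.mpr hne
        exact_mod_cast this
      · exact_mod_cast lt_of_le_of_lt h2 hI1
    have h6 : ((N - k : ℕ) : L) = ((γ : L) - k) + -((γ : L) - N) := by
      rw [Nat.cast_sub (by omega)]; ring
    rw [h6, IsUltrametricDist.norm_add_eq_max_of_norm_ne_norm (by rw [norm_neg]; exact h5.ne'),
      norm_neg, max_eq_left h5.le]
  have hprod : ‖∏ k ∈ Finset.range n, ((γ : L) - (k : L))‖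
      = ‖(n.factorial : L)‖ * ‖(N.choose n : L)‖ := by
    rw [norm_prod, Finset.prod_congr rfl hk, ← norm_prod, ← norm_mul]
    congr 1
    have := Nat.descFactorial_eq_factorial_mul_choose N n
    rw [Nat.descFactorial_eq_prod_range] at this
    exact_mod_cast this
  obtain ⟨hf1, hf2⟩ := aux_factorial p hp R hR1 hR n
  have hch1 := aux_choose (L := L) p hp N n hN1
  have hch2 := IsUltrametricDist.norm_natCast_le_one L (N.choose n)
  have hNb : (N : ℝ) + 1 ≤ (2 + p * C0) * (n + 1) := by
    have : N + 1 ≤ (2 + p * C0) * (n + 1) := by nlinarith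
    exact_mod_cast this
  have hRn : 0 < (R ^ n)⁻¹ := by positivity
  have hn0 : (0 : ℝ) ≤ n := by positivity
  have hC0' : (0 : ℝ) ≤ C0 := by positivity
  rw [hprod]
  constructor
  · refine (mul_le_of_le_one_right (norm_nonneg _) hch2).trans (hf2.trans ?_)
    gcongr
    apply le_mul_of_one_le_right (by positivity)
    nlinarith
  · have h7 : 1 ≤ (2 + p * C0) * (n + 1) * ‖(N.choose n : L)‖ := by
      have hN0 : (0 : ℝ) < (N : ℝ) + 1 := by positivity
      calc (1 : ℝ) = ((N : ℝ) + 1) * ((N : ℝ) + 1)⁻¹ := by field_simp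
        _ ≤ _ := by gcongr
    calc (R ^ n)⁻¹ ≤ ‖(n.factorial : L)‖ * 1 := by simpa using hf1
      _ ≤ ‖(n.factorial : L)‖ * ((2 + p * C0) * (n + 1) * ‖(N.choose n : L)‖) := by gcongr
      _ = 1 * ((2 + p * C0) * (n + 1) * (‖(n.factorial : L)‖ * ‖(N.choose n : L)‖)) := by ring
      _ ≤ p * ((2 + p * C0) * (n + 1) * (‖(n.factorial : L)‖ * ‖(N.choose n : L)‖)) := by gcongr
      _ = _ := by ring

theorem aux_le_matMaxNorm {L : Type*} [NormedField L] {m n : Type*} [Fintype m] [Fintype n]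
    [Nonempty m] [Nonempty n] (Y : Matrix m n L) (i : m) (j : n) : ‖Y i j‖ ≤ matMaxNorm Y := by
  unfold matMaxNorm
  exact (Finset.le_sup' (fun j : n => ‖Y i j‖) (Finset.mem_univ j)).trans
    (Finset.le_sup' (fun i : m => Finset.univ.sup' Finset.univ_nonempty (fun j : n => ‖Y i j‖))
      (Finset.mem_univ i))

theorem aux_matMaxNorm_le {L : Type*} [NormedField L] {m n : Type*} [Fintype m] [Fintype n]
    [Nonempty m] [Nonempty n] (Y : Matrix m n L) (B : ℝ) (h : ∀ i j, ‖Y i j‖ ≤ B) :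
    matMaxNorm Y ≤ B := by
  unfold matMaxNorm
  exact Finset.sup'_le _ _ fun i _ => Finset.sup'_le _ _ fun j _ => h i j

/-- Polynomially-corrected exponential growth of the entries of `downProd M n * W`. -/
def AuxGrow {L : Type*} [NormedField L] {ν : ℕ} (R : ℝ) (M W : Matrix (Fin ν) (Fin ν) L) : Prop :=
  ∃ K : ℝ, ∃ d : ℕ, 0 ≤ K ∧ ∀ (n : ℕ) i j, ‖(downProd M n * W) i j‖ ≤ K * ((n : ℝ) + 1) ^ d * R ^ n

theorem aux_step {L : Type*} [NormedField L] [IsUltrametricDist L] {ν : ℕ} (R : ℝ) (hR1 : 1 ≤ R)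
    (M W : Matrix (Fin ν) (Fin ν) L)
    (hinv : ∀ k : ℕ, IsUnit (M - (k : L) • (1 : Matrix (Fin ν) (Fin ν) L)).det)
    (g : L) (C : ℝ) (hC : 1 ≤ C)
    (hc : ∀ n : ℕ, ‖∏ k ∈ Finset.range n, (g - (k : L))‖ ≤ C * (n + 1) * (R ^ n)⁻¹ ∧
      (R ^ n)⁻¹ ≤ C * (n + 1) * ‖∏ k ∈ Finset.range n, (g - (k : L))‖)
    (h : AuxGrow R M ((M - g • (1 : Matrix (Fin ν) (Fin ν) L)) * W)) : AuxGrow R M W := by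
  obtain ⟨K, d, hK, hb⟩ := h
  have hR0 : 0 < R := by linarith
  set c : ℕ → L := fun n => ∏ k ∈ Finset.range n, (g - (k : L)) with hcdef
  have hrec : ∀ n, downProd M n * W = downProd M (n + 1) * ((M - g • (1 : Matrix (Fin ν) (Fin ν) L)) * W)
      + (g - (n : L)) • (downProd M (n + 1) * W) := by
    intro n
    have h1 : downProd M (n + 1) * (M - (n : L) • (1 : Matrix (Fin ν) (Fin ν) L)) = downProd M n := by
      rw [downProd, Matrix.mul_assoc, Matrix.nonsing_inv_mul _ (hinv n), Matrix.mul_one]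
    have h2 : (M - (n : L) • (1 : Matrix (Fin ν) (Fin ν) L))
        = (M - g • (1 : Matrix (Fin ν) (Fin ν) L)) + (g - (n : L)) • (1 : Matrix (Fin ν) (Fin ν) L) := by
      rw [sub_smul]; abel
    conv_lhs => rw [← h1, h2]
    rw [Matrix.mul_assoc, Matrix.add_mul, Matrix.mul_add, Matrix.smul_mul, Matrix.one_mul,
      Matrix.mul_smul]
  obtain ⟨w, hw0, hw⟩ : ∃ w : ℝ, 0 ≤ w ∧ ∀ i j, ‖W i j‖ ≤ w := by
    refine ⟨∑ i, ∑ j, ‖W i j‖, by positivity, fun i j => ?_⟩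
    exact (Finset.single_le_sum (f := fun j => ‖W i j‖) (fun _ _ => norm_nonneg _)
      (Finset.mem_univ j)).trans (Finset.single_le_sum (f := fun i => ∑ j, ‖W i j‖)
        (fun _ _ => by positivity) (Finset.mem_univ i))
  set K' := w + C * K * R with hK'
  have hK'0 : 0 ≤ K' := by positivity
  have hE : ∀ (n : ℕ) i j, ‖c n * (downProd M n * W) i j‖ ≤ K' * ((n : ℝ) + 1) ^ (d + 1) := by
    intro n i j
    induction n with
    | zero =>
      have : w ≤ K' := by rw [hK']; have : 0 ≤ C * K * R := by positivity
                          linarith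
      simpa [hcdef, downProd] using (hw i j).trans this
    | succ n ih =>
      have h3 := congrFun (congrFun (hrec n) i) j
      rw [Matrix.add_apply, Matrix.smul_apply, smul_eq_mul] at h3
      have h4 : c (n + 1) * (downProd M (n + 1) * W) i j = c n * (downProd M n * W) i j
          + -(c n * (downProd M (n + 1) * ((M - g • (1 : Matrix (Fin ν) (Fin ν) L)) * W)) i j) := by
        have : c (n + 1) = c n * (g - n) := by simp [hcdef, Finset.prod_range_succ]
        rw [this, h3]; ring
      rw [h4]
      refine (IsUltrametricDist.norm_add_le_max _ _).trans (max_le ?_ ?_)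
      · refine ih.trans ?_
        push_cast
        gcongr
        linarith
      · rw [norm_neg, norm_mul]
        calc _ ≤ (C * (n + 1) * (R ^ n)⁻¹) * (K * (((n + 1 : ℕ) : ℝ) + 1) ^ d * R ^ (n + 1)) :=
              mul_le_mul (hc n).1 (hb (n + 1) i j) (norm_nonneg _) (by positivity)
          _ = C * K * R * ((((n + 1 : ℕ) : ℝ) + 1) ^ d * (n + 1)) := by
              rw [pow_succ R]; field_simp
          _ ≤ K' * ((((n + 1 : ℕ) : ℝ) + 1) ^ d * (((n + 1 : ℕ) : ℝ) + 1)) := by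
              have : C * K * R ≤ K' := by rw [hK']; linarith
              gcongr
              push_cast
              linarith
          _ = _ := by rw [← pow_succ]
  refine ⟨C * K', d + 2, by positivity, fun n i j => ?_⟩
  have h5 := hE n i j
  rw [norm_mul] at h5
  have h6 := (hc n).2
  set x := ‖(downProd M n * W) i j‖
  have hx : 0 ≤ x := norm_nonneg _
  have hRn : 0 < R ^ n := by positivity
  calc x = (R ^ n)⁻¹ * x * R ^ n := by field_simp
    _ ≤ (C * (n + 1) * ‖c n‖) * x * R ^ n := by gcongr
    _ = C * (n + 1) * (‖c n‖ * x) * R ^ n := by ring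
    _ ≤ C * (n + 1) * (K' * ((n : ℝ) + 1) ^ (d + 1)) * R ^ n := by gcongr
    _ = _ := by ring

theorem aux_list {L : Type*} [NormedField L] [IsUltrametricDist L] {ν : ℕ} (R : ℝ) (hR1 : 1 ≤ R)
    (M : Matrix (Fin ν) (Fin ν) L)
    (hinv : ∀ k : ℕ, IsUnit (M - (k : L) • (1 : Matrix (Fin ν) (Fin ν) L)).det)
    (l : List L)
    (hl : ∀ g ∈ l, ∃ C : ℝ, 1 ≤ C ∧ ∀ n : ℕ,
      ‖∏ k ∈ Finset.range n, (g - (k : L))‖ ≤ C * (n + 1) * (R ^ n)⁻¹ ∧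
      (R ^ n)⁻¹ ≤ C * (n + 1) * ‖∏ k ∈ Finset.range n, (g - (k : L))‖)
    (h : AuxGrow R M (l.map fun g => M - g • (1 : Matrix (Fin ν) (Fin ν) L)).prod) :
    AuxGrow R M 1 := by
  induction l with
  | nil => simpa using h
  | cons g l ih =>
    apply ih (fun g' hg' => hl g' (List.mem_cons_of_mem _ hg'))
    obtain ⟨C, hC, hc⟩ := hl g List.mem_cons_self
    rw [List.map_cons, List.prod_cons] at h
    exact aux_step R hR1 M _ hinv g C hC hc h

theorem aux_root_one (K : ℝ) (hK : 0 < K) (d : ℕ) :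
    Tendsto (fun n : ℕ => (K * ((n : ℝ) + 1) ^ d) ^ ((1 : ℝ) / n)) atTop (nhds 1) := by
  have h1 : Tendsto (fun n : ℕ => (1 : ℝ) / n) atTop (nhds 0) := tendsto_one_div_atTop_nhds_zero_nat
  have h2 : Tendsto (fun n : ℕ => K ^ ((1 : ℝ) / n)) atTop (nhds 1) := by
    have := (Real.continuousAt_const_rpow (a := K) (b := 0) hK.ne').tendsto.comp h1
    simpa [Function.comp_def] using this
  have h3 : Tendsto (fun n : ℕ => ((n : ℝ) + 1) ^ ((1 : ℝ) / n)) atTop (nhds 1) := by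
    have h4 := tendsto_rpow_div_mul_add 1 1 (-1) (by norm_num)
    have h5 : Tendsto (fun n : ℕ => (n : ℝ) + 1) atTop atTop :=
      tendsto_atTop_add_const_right _ _ tendsto_natCast_atTop_atTop
    have := h4.comp h5
    refine this.congr fun n => ?_
    simp [Function.comp]
  have h6 := h2.mul (h3.pow d)
  rw [one_pow, mul_one] at h6
  refine h6.congr fun n => ?_
  rw [Real.mul_rpow hK.le (by positivity)]
  congr 1
  rw [← Real.rpow_natCast, ← Real.rpow_mul (by positivity), ← Real.rpow_natCast,
    ← Real.rpow_mul (by positivity), mul_comm]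

theorem aux_squeeze (f : ℕ → ℝ) (B C K : ℝ) (d : ℕ) (hB : 0 < B) (hC : 0 < C) (hK : 0 < K)
    (h1 : ∀ n : ℕ, B ^ n ≤ C * ((n : ℝ) + 1) * f n)
    (h2 : ∀ n : ℕ, f n ≤ K * ((n : ℝ) + 1) ^ d * B ^ n) :
    Tendsto (fun n : ℕ => f n ^ ((1 : ℝ) / n)) atTop (nhds B) := by
  have hBn : ∀ n : ℕ, n ≠ 0 → (B ^ n) ^ ((1 : ℝ) / n) = B := fun n hn => by
    rw [one_div]; exact Real.pow_rpow_inv_natCast hB.le hn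
  have hlo := (tendsto_const_nhds (x := B)).mul ((aux_root_one C hC 1).inv₀ one_ne_zero)
  have hup := (aux_root_one K hK d).mul (tendsto_const_nhds (x := B))
  rw [inv_one, mul_one] at hlo
  rw [one_mul] at hup
  have hf : ∀ n, 0 ≤ f n := fun n => by
    by_contra hneg
    push Not at hneg
    have : 0 < B ^ n := by positivity
    have h3 : 0 < C * ((n : ℝ) + 1) := by positivity
    nlinarith [h1 n]
  refine tendsto_of_tendsto_of_tendsto_of_le_of_le' hlo hup ?_ ?_
  · filter_upwards [eventually_ne_atTop 0] with n hn
    have h3 : 0 < C * ((n : ℝ) + 1) ^ 1 := by positivity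
    rw [← div_eq_mul_inv, div_le_iff₀ (Real.rpow_pos_of_pos h3 _),
      ← Real.mul_rpow (hf n) h3.le]
    conv_lhs => rw [← hBn n hn]
    apply Real.rpow_le_rpow (by positivity) _ (by positivity)
    have := h1 n
    rw [pow_one]; linarith
  · filter_upwards [eventually_ne_atTop 0] with n hn
    conv_rhs => rw [← hBn n hn]
    rw [← Real.mul_rpow (by positivity) (by positivity)]
    exact Real.rpow_le_rpow (hf n) (h2 n) (by positivity)

theorem aux_lower {L : Type*} [NormedField L] [IsUltrametricDist L] {ν : ℕ} [NeZero ν]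
    (M : Matrix (Fin ν) (Fin ν) L)
    (hinv : ∀ k : ℕ, IsUnit (M - (k : L) • (1 : Matrix (Fin ν) (Fin ν) L)).det)
    (g : L) (hg : (M - g • (1 : Matrix (Fin ν) (Fin ν) L)).det = 0) (n : ℕ) :
    1 ≤ matMaxNorm (downProd M n) * ‖∏ k ∈ Finset.range n, (g - (k : L))‖ := by
  obtain ⟨v, hv0, hv⟩ := Matrix.exists_mulVec_eq_zero_iff.mpr hg
  have key : ∀ n : ℕ, (∏ k ∈ Finset.range n, (g - (k : L))) • (downProd M n).mulVec v = v := by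
    intro n
    induction n with
    | zero => simp [downProd]
    | succ n ih =>
      have h1 : (M - (n : L) • (1 : Matrix (Fin ν) (Fin ν) L)).mulVec v = (g - (n : L)) • v := by
        have h2 : (M - (n : L) • (1 : Matrix (Fin ν) (Fin ν) L))
          = (M - g • (1 : Matrix (Fin ν) (Fin ν) L))
            + (g - (n : L)) • (1 : Matrix (Fin ν) (Fin ν) L) := by
          rw [sub_smul]; abel
        rw [h2, Matrix.add_mulVec, hv, Matrix.smul_mulVec, Matrix.one_mulVec, zero_add]
      have h3 : (g - (n : L)) • (M - (n : L) • (1 : Matrix (Fin ν) (Fin ν) L))⁻¹.mulVec v = v := by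
        rw [← Matrix.mulVec_smul, ← h1, Matrix.mulVec_mulVec, Matrix.nonsing_inv_mul _ (hinv n),
          Matrix.one_mulVec]
      rw [downProd, ← Matrix.mulVec_mulVec, Finset.prod_range_succ, mul_smul, ← Matrix.mulVec_smul,
        h3, ih]
  obtain ⟨i, -, hi⟩ := Finset.exists_max_image Finset.univ (fun i => ‖v i‖)
    ⟨(0 : Fin ν), Finset.mem_univ _⟩
  have hvi : 0 < ‖v i‖ := by
    obtain ⟨j, hj⟩ := Function.ne_iff.mp hv0
    exact lt_of_lt_of_le (norm_pos_iff.mpr hj) (hi j (Finset.mem_univ j))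
  have h4 := congrArg norm (congrFun (key n) i)
  rw [Pi.smul_apply, norm_smul] at h4
  have hnn : 0 ≤ matMaxNorm (downProd M n) :=
    (norm_nonneg _).trans (aux_le_matMaxNorm (downProd M n) i i)
  have h5 : ‖(downProd M n).mulVec v i‖ ≤ matMaxNorm (downProd M n) * ‖v i‖ := by
    rw [Matrix.mulVec, dotProduct]
    refine IsUltrametricDist.norm_sum_le_of_forall_le_of_nonneg (by positivity) fun j _ => ?_
    rw [norm_mul]
    exact mul_le_mul (aux_le_matMaxNorm _ i j) (hi j (Finset.mem_univ j)) (norm_nonneg _) hnn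
  set P := ‖∏ k ∈ Finset.range n, (g - (k : L))‖
  have hP : 0 ≤ P := norm_nonneg _
  refine le_of_mul_le_mul_right ?_ hvi
  rw [one_mul]
  calc ‖v i‖ = P * ‖(downProd M n).mulVec v i‖ := h4.symm
    _ ≤ P * (matMaxNorm (downProd M n) * ‖v i‖) := by gcongr
    _ = _ := by ring

/-- For `Λ ∈ GL_ν(ℚ)` with all eigenvalues in `ℚ ∩ ℤ_p \ ℤ` and `τ ≠ 0`,
`lim_{n→∞} ‖C_{Λ,τ}(-n)‖_v^{1/n} = |τ|_v · p^{1/(p-1)}`, where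
`C_{Λ,τ}(-n) = τ^n Λ⁻¹ (Λ-I)⁻¹ ⋯ (Λ-(n-1)I)⁻¹`. -/
theorem Cmat_neg_norm_root_tendsto
    (p : ℕ) [Fact p.Prime] {L : Type*} [NontriviallyNormedField L] [CharZero L]
    (hna : ∀ x y : L, ‖x + y‖ ≤ max ‖x‖ ‖y‖) (hp : ‖(p : L)‖ = (p : ℝ)⁻¹)
    (τ : L) (hτ : τ ≠ 0) (ν : ℕ) [NeZero ν]
    (Λ : Matrix (Fin ν) (Fin ν) ℚ) (hΛ : IsUnit Λ.det) (γ : Fin ν → ℚ)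
    (hcp : Λ.charpoly = ∏ j, (Polynomial.X - Polynomial.C (γ j)))
    (hint : ∀ j, ‖((γ j : ℚ) : L)‖ ≤ 1) (hnotZ : ∀ j, ∀ z : ℤ, γ j ≠ (z : ℚ)) :
    Tendsto
      (fun n : ℕ =>
        matMaxNorm (τ ^ n • downProd (Λ.map (fun q : ℚ => (q : L))) n) ^ ((1 : ℝ) / n))
      atTop (nhds (‖τ‖ * (p : ℝ) ^ ((1 : ℝ) / ((p : ℝ) - 1)))) := by
  haveI : IsUltrametricDist L :=
    IsUltrametricDist.isUltrametricDist_of_forall_norm_add_le_max_norm hna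
  have hpp : p.Prime := Fact.out
  have hp1 : (1 : ℝ) < p := by exact_mod_cast hpp.one_lt
  set R : ℝ := (p : ℝ) ^ ((1 : ℝ) / ((p : ℝ) - 1)) with hRdef
  have hR1 : 1 ≤ R := Real.one_le_rpow hp1.le (div_nonneg zero_le_one (by linarith))
  have hR0 : 0 < R := by linarith
  have hR : R ^ (p - 1) = p := by
    rw [hRdef, ← Real.rpow_natCast, ← Real.rpow_mul (by linarith), Nat.cast_sub hpp.one_le,
      Nat.cast_one, one_div, inv_mul_cancel₀ (by linarith), Real.rpow_one]
  set M : Matrix (Fin ν) (Fin ν) L := Λ.map (fun q : ℚ => (q : L)) with hM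
  have hcpM : M.charpoly = ∏ j, (Polynomial.X - Polynomial.C ((γ j : ℚ) : L)) := by
    have h := Matrix.charpoly_map Λ (Rat.castHom L)
    rw [hcp, Polynomial.map_prod] at h
    simpa using h
  have hdet : ∀ t : L, (M - t • (1 : Matrix (Fin ν) (Fin ν) L)).det
      = (-1) ^ ν * ∏ j, (t - ((γ j : ℚ) : L)) := by
    intro t
    have h := Matrix.eval_charpoly M t
    rw [hcpM, Polynomial.eval_prod] at h
    simp only [Polynomial.eval_sub, Polynomial.eval_X, Polynomial.eval_C] at h
    rw [h, ← neg_sub, Matrix.det_neg, Fintype.card_fin]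
    congr 3
    rw [Matrix.scalar_apply, Matrix.smul_one_eq_diagonal]
  have hinv : ∀ k : ℕ, IsUnit (M - (k : L) • (1 : Matrix (Fin ν) (Fin ν) L)).det := by
    intro k
    rw [hdet, isUnit_iff_ne_zero]
    refine mul_ne_zero (pow_ne_zero _ (by simp)) (Finset.prod_ne_zero_iff.mpr fun j _ => ?_)
    rw [sub_ne_zero]
    intro h
    apply hnotZ j k
    have : ((k : ℚ) : L) = ((γ j : ℚ) : L) := by simpa using h
    have := Rat.cast_injective this
    rw [← this]; simp
  have hcb := fun j => aux_c_bound p hp R hR1 hR (γ j) (hint j) (hnotZ j)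
  have hgrow : AuxGrow R M 1 := by
    apply aux_list R hR1 M hinv (Finset.univ.toList.map fun j => ((γ j : ℚ) : L))
    · intro g hg
      obtain ⟨j, -, rfl⟩ := List.mem_map.mp hg
      exact hcb j
    · have h := Matrix.aeval_self_charpoly M
      rw [hcpM, ← Finset.prod_map_toList, map_list_prod, List.map_map] at h
      have h0 : ((Finset.univ.toList.map fun j => ((γ j : ℚ) : L)).map
          fun g => M - g • (1 : Matrix (Fin ν) (Fin ν) L)).prod = 0 := by
        rw [List.map_map, ← h]
        congr 1
        apply List.map_congr_left
        intro j _
        simp [Algebra.algebraMap_eq_smul_one]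
      rw [h0]
      exact ⟨0, 0, le_rfl, fun n i j => by simp⟩
  obtain ⟨K, d, hK, hup⟩ := hgrow
  obtain ⟨C, hC, hc⟩ := hcb 0
  have hlow := aux_lower M hinv ((γ 0 : ℚ) : L) (by
    rw [hdet, Finset.prod_eq_zero (Finset.mem_univ 0) (sub_self _), mul_zero])
  have hτ0 : 0 < ‖τ‖ := norm_pos_iff.mpr hτ
  have hle : ∀ n : ℕ, ‖τ‖ ^ n * matMaxNorm (downProd M n) ≤ matMaxNorm (τ ^ n • downProd M n) := by
    intro n
    have hpos : 0 < ‖τ‖ ^ n := by positivity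
    rw [← le_div_iff₀' hpos]
    apply aux_matMaxNorm_le
    intro i j
    rw [le_div_iff₀' hpos]
    have := aux_le_matMaxNorm (τ ^ n • downProd M n) i j
    rwa [Matrix.smul_apply, norm_smul, norm_pow] at this
  refine aux_squeeze _ (‖τ‖ * R) C (K + 1) d (by positivity) (by positivity) (by positivity) ?_ ?_
  · intro n
    set P := ‖∏ k ∈ Finset.range n, (((γ 0 : ℚ) : L) - (k : L))‖
    set D := matMaxNorm (downProd M n) with hD
    have hD0 : 0 ≤ D := (norm_nonneg _).trans (aux_le_matMaxNorm (downProd M n) 0 0)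
    have hRn : 0 < R ^ n := by positivity
    have h1 : R ^ n ≤ C * (n + 1) * D := by
      calc R ^ n ≤ R ^ n * (D * P) := le_mul_of_one_le_right hRn.le (hlow n)
        _ ≤ R ^ n * (D * (C * (n + 1) * (R ^ n)⁻¹)) := by gcongr; exact (hc n).1
        _ = _ := by field_simp
    calc (‖τ‖ * R) ^ n = ‖τ‖ ^ n * R ^ n := mul_pow _ _ _
      _ ≤ ‖τ‖ ^ n * (C * (n + 1) * D) := by gcongr
      _ = C * (n + 1) * (‖τ‖ ^ n * D) := by ring
      _ ≤ _ := by gcongr; exact hle n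
  · intro n
    apply aux_matMaxNorm_le
    intro i j
    have h := hup n i j
    rw [Matrix.mul_one] at h
    rw [Matrix.smul_apply, norm_smul, norm_pow, mul_pow]
    calc ‖τ‖ ^ n * ‖downProd M n i j‖ ≤ ‖τ‖ ^ n * (K * ((n : ℝ) + 1) ^ d * R ^ n) := by gcongr
      _ ≤ ‖τ‖ ^ n * ((K + 1) * ((n : ℝ) + 1) ^ d * R ^ n) := by gcongr; linarith
      _ = _ := by ring
end
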